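/- For every α with 0 < α ≤ 1, the inclusion H_{log^α}^{τ+1}(𝕋^n) ⊂ L̃²_{τ+1,b}(𝕋^n) fails: there exists a family of Fourier coefficients (f_k)_{k∈ℤ^n} such that ∑_{k∈ℤ^n} |f_k|² |k|^{2τ+2} (ln(1+|k|))^α < ∞ while ∑_{ν=0}^∞ ( ∑_{b^{ν−1} < |k| ≤ b^ν} |f_k|² |k|^{2τ+2} )^{1/2} = +∞. -/

import Mathlib

open scoped BigOperators ENNReal
open MeasureTheory

noncomputable section

/-- The ℓ¹ norm `|k| = ∑ |k_j|` of an integer vector `k ∈ ℤ^n`. -/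
def knorm {n : ℕ} (k : Fin n → ℤ) : ℝ := ∑ j, |(k j : ℝ)|

/-- The dyadic-type block sum `∑_{b^{ν-1} < |k| ≤ b^ν} F(k)² |k|^{2τ+2}`,
where `F k` plays the role of `|f_k|`. -/
def blockSum (n b : ℕ) (τ : ℝ) (F : (Fin n → ℤ) → ℝ) (ν : ℕ) : ℝ :=
  ∑' k : Fin n → ℤ,
    if (b : ℝ) ^ ((ν : ℤ) - 1) < knorm k ∧ knorm k ≤ (b : ℝ) ^ (ν : ℕ) then
      F k ^ 2 * knorm k ^ (2 * τ + 2) else 0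

/-- `1 / (m (⌊log₂ m⌋ + 1))`, a divergent series whose squares weighted by `m` are summable. -/
def logWeight (m : ℕ) : ℝ := 1 / ((m : ℝ) * ((Nat.log 2 m : ℝ) + 1))

lemma logWeight_nonneg (m : ℕ) : 0 ≤ logWeight m := by
  unfold logWeight; positivity

lemma not_summable_logWeight : ¬ Summable logWeight := by
  rw [← summable_condensed_iff_of_nonneg logWeight_nonneg]
  · have h : (fun k : ℕ => (2 : ℝ) ^ k * logWeight (2 ^ k)) =
        fun k : ℕ => 1 / (((k + 1 : ℕ) : ℝ)) := by
      funext k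
      simp only [logWeight, Nat.log_pow one_lt_two]
      push_cast
      field_simp
    rw [h, summable_nat_add_iff 1 (f := fun k : ℕ => 1 / (k : ℝ))]
    exact Real.not_summable_one_div_natCast
  · intro m m' hm hmm'
    have h1 : (0 : ℝ) < m := by exact_mod_cast hm
    have h2 : (m : ℝ) ≤ m' := by exact_mod_cast hmm'
    have h3 : (Nat.log 2 m : ℝ) ≤ Nat.log 2 m' := by exact_mod_cast Nat.log_mono_right hmm'
    unfold logWeight
    gcongr

lemma summable_mul_logWeight_sq : Summable fun m : ℕ => (m : ℝ) * logWeight m ^ 2 := by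
  have heq : (fun m : ℕ => (m : ℝ) * logWeight m ^ 2) =
      fun m : ℕ => 1 / ((m : ℝ) * ((Nat.log 2 m : ℝ) + 1) ^ 2) := by
    funext m
    rcases eq_or_ne m 0 with rfl | hm
    · simp
    · have : (m : ℝ) ≠ 0 := by exact_mod_cast hm
      unfold logWeight
      field_simp
  rw [heq, ← summable_condensed_iff_of_nonneg (fun m => by positivity)]
  · have h : (fun k : ℕ => (2 : ℝ) ^ k *
        (1 / (((2 ^ k : ℕ) : ℝ) * ((Nat.log 2 (2 ^ k) : ℝ) + 1) ^ 2))) =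
        fun k : ℕ => 1 / (((k + 1 : ℕ) : ℝ)) ^ 2 := by
      funext k
      simp only [Nat.log_pow one_lt_two]
      push_cast
      field_simp
    rw [h, summable_nat_add_iff 1 (f := fun k : ℕ => 1 / (k : ℝ) ^ 2)]
    exact Real.summable_one_div_nat_pow.2 one_lt_two
  · intro m m' hm hmm'
    have h1 : (0 : ℝ) < m := by exact_mod_cast hm
    have h2 : (m : ℝ) ≤ m' := by exact_mod_cast hmm'
    have h3 : (Nat.log 2 m : ℝ) ≤ Nat.log 2 m' := by exact_mod_cast Nat.log_mono_right hmm'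
    gcongr

lemma knorm_single {n : ℕ} (i : Fin n) (x : ℤ) :
    knorm (Pi.single i x : Fin n → ℤ) = |(x : ℝ)| := by
  unfold knorm
  rw [Finset.sum_eq_single i]
  · simp
  · intro j _ hj
    simp [Pi.single_eq_of_ne hj]
  · simp

lemma log_one_add_pow_rpow_le {b m : ℕ} (hb : 2 ≤ b) (hm : 1 ≤ m) {α : ℝ} (hα0 : 0 ≤ α)
    (hα1 : α ≤ 1) :
    Real.log (1 + (b : ℝ) ^ m) ^ α ≤ (2 * Real.log b + 1) * m := by
  have hb' : (2 : ℝ) ≤ b := by exact_mod_cast hb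
  have hm' : (1 : ℝ) ≤ m := by exact_mod_cast hm
  have hpow : (1 : ℝ) ≤ (b : ℝ) ^ m := one_le_pow₀ (by linarith)
  have hlogb : 0 ≤ Real.log b := Real.log_nonneg (by linarith)
  have hlog : Real.log (1 + (b : ℝ) ^ m) ≤ (2 * Real.log b + 1) * m := by
    have h : Real.log (1 + (b : ℝ) ^ m) ≤ Real.log ((b : ℝ) ^ (m + 1)) := by
      apply Real.log_le_log (by positivity)
      rw [pow_succ]
      nlinarith
    rw [Real.log_pow] at h
    push_cast at h
    nlinarith
  calc Real.log (1 + (b : ℝ) ^ m) ^ α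
      ≤ ((2 * Real.log b + 1) * m) ^ α :=
        Real.rpow_le_rpow (Real.log_nonneg (by linarith)) hlog hα0
    _ ≤ ((2 * Real.log b + 1) * m) ^ (1 : ℝ) :=
        Real.rpow_le_rpow_of_exponent_le (by nlinarith) hα1
    _ = _ := Real.rpow_one _

/-- For `0 < α ≤ 1` the inclusion `H_{log^α}^{τ+1}(𝕋^n) ⊆ L̃²_{τ+1,b}(𝕋^n)`
fails: there are Fourier coefficients with finite `H_{log^α}^{τ+1}` norm whose
`L̃²_{τ+1,b}` norm diverges. -/
theorem stmt2 (n b : ℕ) (hn : 2 ≤ n) (hb : 2 ≤ b) (τ : ℝ) (hτ : (n : ℝ) - 1 ≤ τ)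
    (α : ℝ) (hα0 : 0 < α) (hα1 : α ≤ 1) :
    ∃ f : (Fin n → ℤ) → ℂ,
      (Summable fun k : Fin n → ℤ =>
        ‖f k‖ ^ 2 * knorm k ^ (2 * τ + 2) * Real.log (1 + knorm k) ^ α) ∧
      ¬ Summable fun ν : ℕ => Real.sqrt (blockSum n b τ (fun k => ‖f k‖) ν) := by
  have hb1 : (1 : ℝ) < b := by exact_mod_cast hb
  have hb0 : (0 : ℝ) < b := by linarith
  let e : ℕ → Fin n → ℤ := fun ν => Pi.single ⟨0, by omega⟩ ((b : ℤ) ^ ν)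
  let c : ℕ → ℂ := fun ν => ((logWeight ν * ((b : ℝ) ^ ν) ^ (-(τ + 1)) : ℝ) : ℂ)
  have hnorm (ν : ℕ) : knorm (e ν) = (b : ℝ) ^ ν := by
    rw [knorm_single]
    push_cast
    exact abs_of_pos (by positivity)
  have he : Function.Injective e := fun μ ν h =>
    pow_right_injective₀ hb0 hb1.ne' <| by
      simpa only [hnorm] using congrArg knorm h
  have hf (ν : ℕ) : Function.extend e c (0 : (Fin n → ℤ) → ℂ) (e ν) = c ν :=
    he.extend_apply c 0 ν
  have hf0 (k : Fin n → ℤ) (hk : k ∉ Set.range e) :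
      Function.extend e c (0 : (Fin n → ℤ) → ℂ) k = 0 :=
    Function.extend_apply' (f := e) c (0 : (Fin n → ℤ) → ℂ) k hk
  have hterm (ν : ℕ) : ‖c ν‖ ^ 2 * ((b : ℝ) ^ ν) ^ (2 * τ + 2) = logWeight ν ^ 2 := by
    have hpos : (0 : ℝ) < (b : ℝ) ^ ν := by positivity
    have hexp : (2 * τ + 2) = (τ + 1) * (2 : ℕ) := by push_cast; ring
    rw [Complex.norm_real, Real.norm_eq_abs, sq_abs, hexp, Real.rpow_mul_natCast hpos.le,
      ← mul_pow, mul_assoc, ← Real.rpow_add hpos]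
    simp
  refine ⟨Function.extend e c 0, ?_, ?_⟩
  · rw [← he.summable_iff (fun k hk => by simp [hf0 k hk])]
    refine Summable.of_nonneg_of_le (fun ν => ?_) (fun ν => ?_)
      (summable_mul_logWeight_sq.mul_left (2 * Real.log b + 1))
    · simp only [Function.comp_apply, hf, hnorm, hterm]
      exact mul_nonneg (sq_nonneg _)
        (Real.rpow_nonneg (Real.log_nonneg (le_add_of_nonneg_right (by positivity))) _)
    · simp only [Function.comp_apply, hf, hnorm, hterm]
      rcases Nat.eq_zero_or_pos ν with rfl | hν
      · simp [logWeight]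
      · nlinarith [mul_le_mul_of_nonneg_left (log_one_add_pow_rpow_le hb hν hα0.le hα1)
          (sq_nonneg (logWeight ν))]
  · have hblock (ν : ℕ) :
        blockSum n b τ (fun k => ‖Function.extend e c 0 k‖) ν = logWeight ν ^ 2 := by
      unfold blockSum
      rw [tsum_eq_single (e ν)]
      · simp only [hnorm, hf, hterm]
        rw [if_pos]
        refine ⟨?_, le_rfl⟩
        rw [← zpow_natCast, zpow_lt_zpow_iff_right₀ hb1]
        omega
      · intro k hk
        by_cases hr : k ∈ Set.range e
        · obtain ⟨μ, rfl⟩ := hr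
          rw [hnorm, if_neg]
          rintro ⟨h1, h2⟩
          rw [← zpow_natCast, zpow_lt_zpow_iff_right₀ hb1] at h1
          rw [pow_le_pow_iff_right₀ hb1] at h2
          exact hk (congrArg e (by omega))
        · simp [hf0 k hr]
    simp only [hblock, Real.sqrt_sq (logWeight_nonneg _)]
    exact not_summable_logWeight
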